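/- arXiv:2501.18195 — 8 statements merged into one kernel-verified Lean document; each statement's English description precedes it below -/
import Mathlib

section
/- For all integers n ≥ 1 and m ≥ 1, ∑_{j ∈ {1,…,n+1}^m} ∏_{k=1}^{n+1} M_k(j)! = (n+m)!/n!. Equivalently, the function f(j) = (n!/(n+m)!) · ∏_{k=1}^{n+1} M_k(j)! is a probability mass function on {1,…,n+1}^m, i.e., it is nonnegative and sums to 1. -/
open Nat Finset

/-- The number of coordinates of the tuple `j` that are equal to `k`. -/
def Mcount {m : ℕ} (j : Fin m → ℕ) (k : ℕ) : ℕ :=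
  (Finset.univ.filter (fun i : Fin m => j i = k)).card

lemma Mcount_cons {m : ℕ} (a : ℕ) (j : Fin m → ℕ) (k : ℕ) :
    Mcount (Fin.cons a j : Fin (m + 1) → ℕ) k = (if a = k then 1 else 0) + Mcount j k := by
  simp only [Mcount, Finset.card_filter, Fin.sum_univ_succ, Fin.cons_zero, Fin.cons_succ]

lemma prod_cons {m : ℕ} (s : Finset ℕ) (a : ℕ) (ha : a ∈ s) (j : Fin m → ℕ) :
    ∏ k ∈ s, (Mcount (Fin.cons a j : Fin (m + 1) → ℕ) k)!
      = (Mcount j a + 1) * ∏ k ∈ s, (Mcount j k)! := by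
  rw [← Finset.mul_prod_erase s _ ha, ← Finset.mul_prod_erase s (fun k => (Mcount j k)!) ha,
    ← mul_assoc]
  congr 1
  · rw [Mcount_cons, if_pos rfl, add_comm, Nat.factorial_succ]
  · refine Finset.prod_congr rfl fun k hk => ?_
    rw [Mcount_cons, if_neg (Finset.ne_of_mem_erase hk).symm, zero_add]

lemma sum_Mcount {m : ℕ} (s : Finset ℕ) (j : Fin m → ℕ) (hj : ∀ i, j i ∈ s) :
    ∑ a ∈ s, Mcount j a = m := by
  have h := Finset.card_eq_sum_card_fiberwise (s := (Finset.univ : Finset (Fin m)))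
    (f := j) (t := s) (fun i _ => hj i)
  simpa [Mcount] using h.symm

lemma sum_nat (n m : ℕ) :
    (∑ j ∈ Fintype.piFinset (fun _ : Fin m => Finset.Icc 1 (n + 1)),
      ∏ k ∈ Finset.Icc 1 (n + 1), (Mcount j k)!) * n ! = (n + m)! := by
  induction m with
  | zero => simp [Mcount]
  | succ m ih =>
    have key : ∑ j ∈ Fintype.piFinset (fun _ : Fin (m + 1) => Finset.Icc 1 (n + 1)),
        ∏ k ∈ Finset.Icc 1 (n + 1), (Mcount j k)!
        = ∑ p ∈ Fintype.piFinset (fun _ : Fin m => Finset.Icc 1 (n + 1)) ×ˢ Finset.Icc 1 (n + 1),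
          ∏ k ∈ Finset.Icc 1 (n + 1), (Mcount (Fin.cons p.2 p.1 : Fin (m + 1) → ℕ) k)! := by
      refine Finset.sum_nbij' (fun j => (Fin.tail j, j 0))
        (fun p => (Fin.cons p.2 p.1 : Fin (m + 1) → ℕ)) ?_ ?_ ?_ ?_ ?_
      · intro j hj
        rw [Fintype.mem_piFinset] at hj
        exact Finset.mem_product.2 ⟨Fintype.mem_piFinset.2 fun i => hj i.succ, hj 0⟩
      · intro p hp
        obtain ⟨h1, h2⟩ := Finset.mem_product.1 hp
        rw [Fintype.mem_piFinset] at h1 ⊢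
        intro i
        refine Fin.cases ?_ (fun i => ?_) i
        · exact h2
        · exact h1 i
      · intro j _
        exact Fin.cons_self_tail j
      · intro p _
        rfl
      · intro j _
        simp only [Fin.cons_self_tail]
    rw [key, Finset.sum_product]
    have h2 : ∀ j ∈ Fintype.piFinset (fun _ : Fin m => Finset.Icc 1 (n + 1)),
        ∑ a ∈ Finset.Icc 1 (n + 1),
          ∏ k ∈ Finset.Icc 1 (n + 1), (Mcount (Fin.cons a j : Fin (m + 1) → ℕ) k)!
        = (n + m + 1) * ∏ k ∈ Finset.Icc 1 (n + 1), (Mcount j k)! := by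
      intro j hj
      rw [Finset.sum_congr rfl fun a ha => prod_cons _ a ha j, ← Finset.sum_mul,
        Finset.sum_add_distrib, sum_Mcount _ j (Fintype.mem_piFinset.1 hj)]
      congr 1
      simp
      ring
    rw [Finset.sum_congr rfl h2, ← Finset.mul_sum, mul_assoc, ih, ← add_assoc,
      Nat.factorial_succ]

/-- The joint probability mass function `f(j) = (n!/(n+m)!) ∏_{k=1}^{n+1} M_k(j)!` of
(n+1) times the vector of conformal p-values sums to one over `{1,…,n+1}^m`;
equivalently, `∑_{j ∈ {1,…,n+1}^m} ∏_{k=1}^{n+1} M_k(j)! = (n+m)!/n!`. -/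
theorem conformal_pvalue_pmf_sums_to_one (n m : ℕ) (hn : 1 ≤ n) (hm : 1 ≤ m) :
    ∑ j ∈ Fintype.piFinset (fun _ : Fin m => Finset.Icc 1 (n + 1)),
      ∏ k ∈ Finset.Icc 1 (n + 1), ((Mcount j k)! : ℚ)
      = ((n + m)! : ℚ) / (n ! : ℚ) := by
  rw [eq_div_iff (by exact_mod_cast Nat.factorial_ne_zero n)]
  exact_mod_cast sum_nat n m
end

section
/- Let X = (X_1,…,X_m) be uniformly distributed on O_{n,m}. Then for every integer t with 0 ≤ t ≤ n+1, ℙ(X_1 ≤ t) = 1 − (n!/(n+m)!) · ∏_{k=0}^{m-1} (n+1−t+k). In particular, for α ∈ (0,1), setting t = ⌊α(n+1)⌋ and rejecting any hypothesis whose conformal p-value is at most t/(n+1) gives ℙ(min_j p̂_j ≤ t/(n+1)) where p̂_(1) = X_1/(n+1) is the smallest conformal p-value. -/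
open Nat Finset
open scoped ENNReal

/-- `O_{n,m}`: the set of nondecreasing `m`-tuples with entries in `{1,…,n+1}`. -/
def Onm (n m : ℕ) : Finset (Fin m → ℕ) :=
  (Fintype.piFinset fun _ : Fin m => Finset.Icc 1 (n + 1)).filter
    (fun x => ∀ i k : Fin m, i ≤ k → x i ≤ x k)

def SS (m l M : ℕ) : Finset (Fin m → ℕ) :=
  (Fintype.piFinset fun _ : Fin m => Finset.Icc l M).filter
    (fun x => ∀ i k : Fin m, i ≤ k → x i ≤ x k)

theorem mem_SS {m l M : ℕ} {x : Fin m → ℕ} :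
    x ∈ SS m l M ↔ (∀ i, l ≤ x i ∧ x i ≤ M) ∧ ∀ i k : Fin m, i ≤ k → x i ≤ x k := by
  simp [SS, Fintype.mem_piFinset]

theorem SS_split (m l M : ℕ) (h : l ≤ M) :
    (SS (m+1) l M).card = (SS m l M).card + (SS (m+1) (l+1) M).card := by
  have h1 : SS (m+1) l M =
      (SS m l M).image (fun y => (Fin.cons l y : Fin (m+1) → ℕ)) ∪ SS (m+1) (l+1) M := by
    ext x
    rw [Finset.mem_union, Finset.mem_image]
    constructor
    · intro hx
      rw [mem_SS] at hx
      obtain ⟨hb, hmono⟩ := hx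
      by_cases h0 : x 0 = l
      · left
        refine ⟨Fin.tail x, ?_, ?_⟩
        · rw [mem_SS]
          exact ⟨fun i => hb _, fun i k hik => hmono _ _ (Fin.succ_le_succ_iff.mpr hik)⟩
        · rw [← h0]; exact Fin.cons_self_tail x
      · right
        rw [mem_SS]
        refine ⟨fun i => ⟨?_, (hb i).2⟩, hmono⟩
        have := hmono 0 i (Fin.zero_le i)
        have := (hb 0).1
        omega
    · rintro (⟨y, hy, rfl⟩ | hx)
      · rw [mem_SS] at hy ⊢
        obtain ⟨hb, hmono⟩ := hy
        constructor
        · intro i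
          refine Fin.cases ?_ (fun j => ?_) i
          · simpa using h
          · simpa using hb j
        · intro i
          refine Fin.cases ?_ (fun j => ?_) i
          · intro k _
            refine Fin.cases ?_ (fun j => ?_) k
            · simp
            · simpa using (hb j).1
          · intro k
            refine Fin.cases ?_ (fun j' => ?_) k
            · intro hk
              simp at hk
            · intro hk
              simpa using hmono _ _ (Fin.succ_le_succ_iff.mp hk)
      · rw [mem_SS] at hx ⊢
        exact ⟨fun i => ⟨by have := (hx.1 i).1; omega, (hx.1 i).2⟩, hx.2⟩
  rw [h1, Finset.card_union_of_disjoint, Finset.card_image_of_injective]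
  · exact Fin.cons_right_injective (α := fun _ => ℕ) l
  · rw [Finset.disjoint_left]
    intro x hx hx2
    obtain ⟨y, hy, rfl⟩ := Finset.mem_image.mp hx
    have := ((mem_SS.mp hx2).1 0).1
    simp at this

theorem card_SS (m : ℕ) : ∀ N l M : ℕ, M + 1 = l + N → (SS m l M).card = N.multichoose m := by
  induction m with
  | zero =>
    intro N l M _
    rw [Nat.multichoose_zero_right, Finset.card_eq_one]
    refine ⟨fun i => i.elim0, ?_⟩
    ext x
    rw [mem_SS, Finset.mem_singleton]
    exact ⟨fun _ => Subsingleton.elim _ _, fun _ => ⟨fun i => i.elim0, fun i => i.elim0⟩⟩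
  | succ m ih =>
    intro N
    induction N with
    | zero =>
      intro l M h
      rw [Nat.multichoose_zero_succ, Finset.card_eq_zero, Finset.eq_empty_iff_forall_notMem]
      intro x hx
      have := (mem_SS.mp hx).1 0
      omega
    | succ N ihN =>
      intro l M h
      rw [SS_split m l M (by omega), ih (N+1) l M h, ihN (l+1) M (by omega),
        Nat.multichoose_succ_succ, Nat.add_comm]

theorem fact_mul_multichoose (N m : ℕ) :
    m ! * N.multichoose m = ∏ k ∈ Finset.range m, (N + k) := by
  rw [Nat.multichoose_eq, ← Nat.ascFactorial_eq_factorial_mul_choose', Nat.ascFactorial_eq_prod_range]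

/-- If `X = (X_1,…,X_m)` is uniformly distributed on `O_{n,m}`, then for every
`0 ≤ t ≤ n+1`, `ℙ(X_1 ≤ t) = 1 − (n!/(n+m)!) · ∏_{k=0}^{m-1} (n+1−t+k)`; here
`X_1/(n+1)` is the smallest conformal p-value. -/
theorem smallest_pvalue_cdf (n m t : ℕ) (hn : 1 ≤ n) (hm : 1 ≤ m) (ht : t ≤ n + 1)
    (hne : (Onm n m).Nonempty) :
    (PMF.uniformOfFinset (Onm n m) hne).toOuterMeasure {x | x ⟨0, by omega⟩ ≤ t}
      = 1 - ((n ! : ℕ) : ℝ≥0∞) / (((n + m)! : ℕ) : ℝ≥0∞)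
          * ∏ k ∈ Finset.range m, ((n + 1 - t + k : ℕ) : ℝ≥0∞) := by
  classical
  have hT : (Onm n m).card = (n+1).multichoose m := card_SS m (n+1) 1 (n+1) (by omega)
  have hB : (SS m (t+1) (n+1)).card = (n+1-t).multichoose m :=
    card_SS m (n+1-t) (t+1) (n+1) (by omega)
  have hf : (Onm n m).filter (fun x => ¬ x ⟨0, by omega⟩ ≤ t) = SS m (t+1) (n+1) := by
    ext x
    have e : x ∈ Onm n m ↔ _ := mem_SS (m := m) (l := 1) (M := n+1) (x := x)
    rw [Finset.mem_filter, e, mem_SS]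
    constructor
    · rintro ⟨⟨hb, hmono⟩, h0⟩
      refine ⟨fun i => ⟨?_, (hb i).2⟩, hmono⟩
      have := hmono ⟨0, by omega⟩ i (Fin.mk_le_of_le_val (Nat.zero_le _))
      omega
    · rintro ⟨hb, hmono⟩
      refine ⟨⟨fun i => ⟨?_, (hb i).2⟩, hmono⟩, ?_⟩
      · have := (hb i).1
        omega
      · have := (hb ⟨0, by omega⟩).1
        omega
  have hsum := Finset.card_filter_add_card_filter_not (s := Onm n m)
    (fun x => x ⟨0, by omega⟩ ≤ t)
  rw [hf, hB] at hsum
  have hP := fact_mul_multichoose (n+1-t) m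
  have hN : n ! * (m ! * (Onm n m).card) = (n+m)! := by
    rw [hT, fact_mul_multichoose, ← Nat.ascFactorial_eq_prod_range, Nat.factorial_mul_ascFactorial]
  have hTpos : (Onm n m).card ≠ 0 := hne.card_pos.ne'
  rw [PMF.toOuterMeasure_uniformOfFinset_apply]
  simp only [Set.mem_setOf_eq]
  rw [← Nat.cast_prod, ← hP, ← hN]
  generalize (Onm n m).card = T at *
  generalize (n+1-t).multichoose m = B at *
  have key : ((n ! : ℕ) : ℝ≥0∞) / ((n ! * (m ! * T) : ℕ) : ℝ≥0∞) * ((m ! * B : ℕ) : ℝ≥0∞)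
      = (B : ℝ≥0∞) / T := by
    have e : ((n ! : ℕ) : ℝ≥0∞) / ((n ! * (m ! * T) : ℕ) : ℝ≥0∞) * ((m ! * B : ℕ) : ℝ≥0∞)
      = (((n ! * m ! : ℕ) : ℝ≥0∞) * B) / (((n ! * m ! : ℕ) : ℝ≥0∞) * T) := by
      push_cast
      simp only [div_eq_mul_inv, mul_assoc]
      ring
    rw [e]
    exact ENNReal.mul_div_mul_left _ _
      (Nat.cast_ne_zero.mpr (Nat.mul_ne_zero (Nat.factorial_ne_zero _) (Nat.factorial_ne_zero _)))
      (ENNReal.natCast_ne_top _)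
  rw [key]
  have hT0 : (T : ℝ≥0∞) ≠ 0 := Nat.cast_ne_zero.mpr hTpos
  refine ENNReal.eq_sub_of_add_eq (ENNReal.div_lt_top (ENNReal.natCast_ne_top _) hT0).ne ?_
  rw [ENNReal.div_add_div_same, ENNReal.div_eq_one_iff hT0 (ENNReal.natCast_ne_top _)]
  rw [← hsum]
  push_cast
  congr!
end

section
/- (Šidák procedure controls the FWER for conformal p-values.) Let α ∈ (0,1) and let X = (X_1,…,X_m) be uniformly distributed on O_{n,m}. Then ℙ(X_1/(n+1) ≤ 1 − (1−α)^{1/m}) ≤ α; that is, rejecting every hypothesis whose conformal p-value is at most 1 − (1−α)^{1/m} makes at least one (false) rejection under the global null with probability at most α. -/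
open Nat Finset
open scoped ENNReal

def BB (a d m : ℕ) : Finset (Fin m → ℕ) :=
  (Fintype.piFinset fun _ : Fin m => Finset.Ico a (a + d)).filter
    (fun x => ∀ i k : Fin m, i ≤ k → x i ≤ x k)

lemma mem_BB {a d m : ℕ} {x : Fin m → ℕ} :
    x ∈ BB a d m ↔ (∀ i, a ≤ x i ∧ x i < a + d) ∧ ∀ i k : Fin m, i ≤ k → x i ≤ x k := by
  simp [BB]

lemma BB_step (a d m : ℕ) : BB a (d + 1) (m + 1) =
    BB (a + 1) d (m + 1) ∪ (BB a (d + 1) m).image (fun y => (Fin.cons a y : Fin (m + 1) → ℕ)) := by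
  ext x
  simp only [mem_union, mem_image, mem_BB]
  constructor
  · rintro ⟨h1, h2⟩
    by_cases h : x 0 = a
    · right
      refine ⟨Fin.tail x, ⟨fun i => h1 i.succ, fun i k hik => h2 _ _ (Fin.succ_le_succ_iff.2 hik)⟩, ?_⟩
      rw [← h]; exact Fin.cons_self_tail x
    · left
      refine ⟨fun i => ?_, h2⟩
      have := h1 0
      have := h1 i
      have := h2 0 i (Fin.zero_le _)
      omega
  · rintro (⟨h1, h2⟩ | ⟨y, ⟨h1, h2⟩, rfl⟩)
    · refine ⟨fun i => ?_, h2⟩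
      have := h1 i
      omega
    · refine ⟨fun i => ?_, fun i k hik => ?_⟩
      · refine Fin.cases ?_ (fun j => ?_) i
        · simp
        · simpa using h1 j
      · induction i using Fin.cases with
        | zero =>
          induction k using Fin.cases with
          | zero => simp
          | succ k => simpa using (h1 k).1
        | succ i =>
          induction k using Fin.cases with
          | zero => simp at hik
          | succ k => simpa using h2 i k (Fin.succ_le_succ_iff.1 hik)

lemma card_BB (a d m : ℕ) : (BB a d m).card = Nat.multichoose d m := by
  induction m generalizing a d with
  | zero =>
    rw [Nat.multichoose_zero_right, Finset.card_eq_one]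
    refine ⟨Fin.elim0, ?_⟩
    ext x
    simp only [mem_BB, mem_singleton]
    exact ⟨fun _ => Subsingleton.elim _ _, fun _ => ⟨fun i => i.elim0, fun i => i.elim0⟩⟩
  | succ m ihm =>
    induction d generalizing a with
    | zero =>
      rw [Nat.multichoose_zero_succ, Finset.card_eq_zero, Finset.eq_empty_iff_forall_notMem]
      intro x hx
      have := (mem_BB.1 hx).1 0
      omega
    | succ d ihd =>
      rw [BB_step, Finset.card_union_of_disjoint, ihd, Finset.card_image_of_injective, ihm,
        Nat.multichoose_succ_succ]
      · exact Fin.cons_right_injective (α := fun _ => ℕ) a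
      · rw [Finset.disjoint_left]
        intro x hx hx'
        obtain ⟨y, -, rfl⟩ := mem_image.1 hx'
        have := (mem_BB.1 hx).1 0
        simp at this

lemma mc_succ (N m : ℕ) : (m + 1) * Nat.multichoose N (m + 1) = (N + m) * Nat.multichoose N m := by
  rcases N with _ | N
  · rcases m with _ | m <;> simp [Nat.multichoose_zero_succ]
  · rw [Nat.multichoose_eq, Nat.multichoose_eq]
    have := Nat.add_one_mul_choose_eq (N + m) m
    rw [show N + 1 + (m + 1) - 1 = N + m + 1 by omega, show N + 1 + m - 1 = N + m by omega,
      show N + 1 + m = N + m + 1 by omega]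
    linarith

lemma mc_ratio (M N m : ℕ) (h : M ≤ N) :
    Nat.multichoose N m * M ^ m ≤ Nat.multichoose M m * N ^ m := by
  induction m with
  | zero => simp
  | succ m ih =>
    have h1 := mc_succ N m
    have h2 := mc_succ M m
    have h3 : (N + m) * M ≤ (M + m) * N := by nlinarith
    refine Nat.le_of_mul_le_mul_left ?_ (Nat.succ_pos m)
    calc (m + 1) * (Nat.multichoose N (m + 1) * M ^ (m + 1))
        = ((m + 1) * Nat.multichoose N (m + 1)) * M ^ (m + 1) := by ring
      _ = ((N + m) * M) * (Nat.multichoose N m * M ^ m) := by rw [h1]; ring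
      _ ≤ ((M + m) * N) * (Nat.multichoose M m * N ^ m) := Nat.mul_le_mul h3 ih
      _ = ((M + m) * Nat.multichoose M m) * N ^ (m + 1) := by ring
      _ = (m + 1) * (Nat.multichoose M (m + 1) * N ^ (m + 1)) := by rw [← h2]; ring

lemma Onm_eq (n m : ℕ) : Onm n m = BB 1 (n + 1) m := by
  ext x
  simp only [Onm, mem_BB, mem_filter, Fintype.mem_piFinset, Finset.mem_Icc]
  have : ∀ i, (1 ≤ x i ∧ x i ≤ n + 1) ↔ (1 ≤ x i ∧ x i < 1 + (n + 1)) := fun i => by omega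
  simp only [this]

/-- **Šidák procedure controls the FWER for conformal p-values.** If `X = (X_1,…,X_m)` is
uniformly distributed on `O_{n,m}` (so `X_1/(n+1)` is the smallest conformal p-value under
the global null), then for `α ∈ (0,1)`,
`ℙ(X_1/(n+1) ≤ 1 − (1−α)^{1/m}) ≤ α`. -/
theorem sidak_controls_FWER (n m : ℕ) (hn : 1 ≤ n) (hm : 1 ≤ m)
    (hne : (Onm n m).Nonempty) (α : ℝ) (hα : α ∈ Set.Ioo (0 : ℝ) 1) :
    (PMF.uniformOfFinset (Onm n m) hne).toOuterMeasure
        {x | ((x ⟨0, by omega⟩ : ℕ) : ℝ) / (n + 1) ≤ 1 - (1 - α) ^ ((1 : ℝ) / m)}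
      ≤ ENNReal.ofReal α := by
  classical
  obtain ⟨h0, h1⟩ := hα
  rw [PMF.toOuterMeasure_uniformOfFinset_apply]
  have hNpos : (0 : ℝ) < n + 1 := by positivity
  obtain ⟨s, hs⟩ : ∃ s : ℝ, s = (1 - α) ^ ((1 : ℝ) / m) := ⟨_, rfl⟩
  have hs0 : 0 ≤ s := hs ▸ Real.rpow_nonneg (by linarith) _
  have hs1 : s ≤ 1 := hs ▸ Real.rpow_le_one (by linarith) (by linarith) (by positivity)
  have hsm : s ^ m = 1 - α := by
    rw [hs, one_div]
    exact Real.rpow_inv_natCast_pow (by linarith) (by omega)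
  rw [← hs]
  set k := ⌊((n : ℝ) + 1) * (1 - s)⌋₊ with hk
  have hkle : (k : ℝ) ≤ (n + 1) * (1 - s) :=
    Nat.floor_le (mul_nonneg hNpos.le (by linarith))
  have hkn : k ≤ n + 1 := by
    have : (k : ℝ) ≤ ((n + 1 : ℕ) : ℝ) := by push_cast; nlinarith
    exact_mod_cast this
  set z : Fin m := ⟨0, by omega⟩ with hz
  have hOcard : (Onm n m).card = Nat.multichoose (n + 1) m := by rw [Onm_eq, card_BB]
  have hOpos : 0 < (Onm n m).card := hne.card_pos
  have hsum := Finset.card_filter_add_card_filter_not (s := Onm n m)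
    (p := fun x => x ∈ {x : Fin m → ℕ | ((x z : ℕ) : ℝ) / (n + 1) ≤ 1 - s})
  set bad := (Onm n m).filter
    (fun x => x ∈ {x : Fin m → ℕ | ((x z : ℕ) : ℝ) / (n + 1) ≤ 1 - s}) with hbad
  have hgood : Nat.multichoose (n + 1 - k) m ≤ ((Onm n m).filter
    (fun x => ¬ x ∈ {x : Fin m → ℕ | ((x z : ℕ) : ℝ) / (n + 1) ≤ 1 - s})).card := by
    rw [← card_BB (k + 1)]
    apply Finset.card_le_card
    intro x hx
    rw [mem_BB] at hx
    rw [mem_filter, Onm_eq, mem_BB]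
    refine ⟨⟨fun i => ?_, hx.2⟩, ?_⟩
    · have := hx.1 i
      omega
    · simp only [Set.mem_setOf_eq, not_le]
      rw [lt_div_iff₀ hNpos, mul_comm]
      exact Nat.lt_of_floor_lt (hx.1 z).1
  have hr := mc_ratio (n + 1 - k) (n + 1) m (by omega)
  rw [← hOcard] at hr
  have hr' : ((Onm n m).card : ℝ) * ((n : ℝ) + 1 - k) ^ m
      ≤ (Nat.multichoose (n + 1 - k) m : ℝ) * ((n : ℝ) + 1) ^ m := by
    have : (((n + 1 - k : ℕ)) : ℝ) = (n : ℝ) + 1 - k := by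
      rw [Nat.cast_sub hkn]; push_cast; ring
    rw [← this]
    exact_mod_cast hr
  have hpow : (((n : ℝ) + 1) * s) ^ m ≤ ((n : ℝ) + 1 - k) ^ m :=
    pow_le_pow_left₀ (by positivity) (by linarith) m
  rw [mul_pow, hsm] at hpow
  have hOr : (0 : ℝ) < (Onm n m).card := by exact_mod_cast hOpos
  have key : ((Onm n m).card : ℝ) * (1 - α) ≤ (Nat.multichoose (n + 1 - k) m : ℝ) := by
    have hp : (0 : ℝ) < ((n : ℝ) + 1) ^ m := by positivity
    refine le_of_mul_le_mul_right ?_ hp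
    calc _ = ((Onm n m).card : ℝ) * (((n : ℝ) + 1) ^ m * (1 - α)) := by ring
      _ ≤ _ := (mul_le_mul_of_nonneg_left hpow hOr.le).trans hr'
  have hbr : (bad.card : ℝ) ≤ α * (Onm n m).card := by
    have e1 : (Nat.multichoose (n + 1 - k) m : ℝ) + bad.card ≤ (Onm n m).card := by
      exact_mod_cast (by omega : Nat.multichoose (n + 1 - k) m + bad.card ≤ (Onm n m).card)
    linarith
  refine ENNReal.div_le_of_le_mul ?_
  rw [← ENNReal.ofReal_natCast, ← ENNReal.ofReal_natCast, ← ENNReal.ofReal_mul h0.le]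
  apply ENNReal.ofReal_le_ofReal
  convert hbr
end

section
/- For every α ∈ (0,1) and all integers n ≥ 1, m ≥ 1, setting t = ⌊(1 − (1−α)^{1/m})·(n+1)⌋, the following inequality holds: 1 − (n!/(n+m)!) · ∏_{k=0}^{m-1} (n+1−t+k) ≤ α. -/
open Nat Finset

/-- **Arithmetic core of Theorem A.1.** For `α ∈ (0,1)`, `n ≥ 1`, `m ≥ 1` and
`t = ⌊(1 − (1−α)^{1/m})·(n+1)⌋`, we have
`1 − (n!/(n+m)!) · ∏_{k=0}^{m-1} (n+1−t+k) ≤ α`; the left-hand side is the FWER of the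
Šidák procedure applied to conformal p-values under the global null. -/
theorem sidak_FWER_le_alpha (n m : ℕ) (hn : 1 ≤ n) (hm : 1 ≤ m)
    (α : ℝ) (hα : α ∈ Set.Ioo (0 : ℝ) 1) :
    1 - (n ! : ℝ) / ((n + m)! : ℝ)
        * ∏ k ∈ Finset.range m,
            ((n + 1 - ⌊(1 - (1 - α) ^ ((1 : ℝ) / m)) * (n + 1)⌋₊ + k : ℕ) : ℝ)
      ≤ α := by
  obtain ⟨h0, h1⟩ := hα
  have hm0 : m ≠ 0 := by omega
  have hq0 : 0 ≤ (1 - α) ^ ((1 : ℝ) / m) := Real.rpow_nonneg (by linarith) _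
  have hq1 : (1 - α) ^ ((1 : ℝ) / m) ≤ 1 :=
    Real.rpow_le_one (by linarith) (by linarith) (by positivity)
  have hqm : ((1 - α) ^ ((1 : ℝ) / m)) ^ m = 1 - α := by
    rw [one_div]
    exact Real.rpow_inv_natCast_pow (by linarith) hm0
  generalize (1 - α) ^ ((1 : ℝ) / m) = q at *
  have hfl : (⌊(1 - q) * ((n : ℝ) + 1)⌋₊ : ℝ) ≤ (1 - q) * (n + 1) :=
    Nat.floor_le (mul_nonneg (by linarith) (by positivity))
  generalize ⌊(1 - q) * ((n : ℝ) + 1)⌋₊ = t at *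
  have hs : q * ((n : ℝ) + 1) ≤ ((n + 1 - t : ℕ) : ℝ) := by
    have h : n + 1 ≤ (n + 1 - t) + t := by omega
    have h' : (n : ℝ) + 1 ≤ ((n + 1 - t : ℕ) : ℝ) + t := by exact_mod_cast h
    linarith
  have hfac : ∀ j : ℕ, ((n + j)! : ℝ) = n ! * ∏ k ∈ Finset.range j, ((n : ℝ) + 1 + k) := by
    intro j
    induction j with
    | zero => simp
    | succ j ih =>
      rw [Finset.prod_range_succ, ← mul_assoc, ← ih, ← add_assoc, Nat.factorial_succ]
      push_cast
      ring
  have hprod : (1 - α) * ∏ k ∈ Finset.range m, ((n : ℝ) + 1 + k)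
      ≤ ∏ k ∈ Finset.range m, ((n + 1 - t + k : ℕ) : ℝ) := by
    have e : (1 - α) * ∏ k ∈ Finset.range m, ((n : ℝ) + 1 + k)
        = ∏ k ∈ Finset.range m, (q * ((n : ℝ) + 1 + k)) := by
      rw [Finset.prod_mul_distrib, Finset.prod_const, Finset.card_range, hqm]
    rw [e]
    apply Finset.prod_le_prod
    · intro k _
      positivity
    · intro k _
      rw [Nat.cast_add]
      have : q * (k : ℝ) ≤ k := mul_le_of_le_one_left (by positivity) hq1
      linarith
  have hn0 : (0 : ℝ) < n ! := by exact_mod_cast Nat.factorial_pos n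
  have hP : 0 < ∏ k ∈ Finset.range m, ((n : ℝ) + 1 + k) :=
    Finset.prod_pos (fun k _ => by positivity)
  have key : 1 - α ≤ (n ! : ℝ) / ((n + m)! : ℝ)
      * ∏ k ∈ Finset.range m, ((n + 1 - t + k : ℕ) : ℝ) := by
    rw [hfac m, div_mul_eq_mul_div, mul_div_mul_left _ _ hn0.ne', le_div_iff₀ hP]
    exact hprod
  linarith
end

section
/- Fix α ∈ (0,1) and an integer m ≥ 1. For each integer n ≥ 1 set t_n = ⌊(1 − (1−α)^{1/m})·(n+1)⌋ and F_n = 1 − (n!/(n+m)!) · ∏_{k=0}^{m-1} (n+1−t_n+k). Then F_n → α as n → ∞; that is, the family-wise error rate of the Šidák procedure with conformal p-values converges to the nominal level α as the null sample size grows. -/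
open Nat Finset Filter

/-- **Asymptotic exactness of the Šidák procedure (Theorem A.1).** Fix `α ∈ (0,1)` and
`m ≥ 1`. With `t_n = ⌊(1 − (1−α)^{1/m})·(n+1)⌋` and
`F_n = 1 − (n!/(n+m)!) · ∏_{k=0}^{m-1} (n+1−t_n+k)` (the FWER of the Šidák procedure with
conformal p-values under the global null), we have `F_n → α` as `n → ∞`. -/
theorem sidak_FWER_tendsto_alpha (m : ℕ) (hm : 1 ≤ m)
    (α : ℝ) (hα : α ∈ Set.Ioo (0 : ℝ) 1) :
    Filter.Tendsto
      (fun n : ℕ =>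
        1 - (n ! : ℝ) / ((n + m)! : ℝ)
          * ∏ k ∈ Finset.range m,
              ((n + 1 - ⌊(1 - (1 - α) ^ ((1 : ℝ) / m)) * (n + 1)⌋₊ + k : ℕ) : ℝ))
      Filter.atTop (nhds α) := by
  obtain ⟨h0, h1⟩ := hα
  have hm0 : (m : ℝ) ≠ 0 := by
    have : m ≠ 0 := by omega
    exact_mod_cast this
  set b : ℝ := (1 - α) ^ ((1 : ℝ) / m) with hb
  have hb0 : 0 ≤ b := Real.rpow_nonneg (by linarith) _
  have hb1 : b ≤ 1 := Real.rpow_le_one (by linarith) (by linarith) (by positivity)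
  have hbm : b ^ m = 1 - α := by
    rw [hb, ← Real.rpow_natCast, ← Real.rpow_mul (by linarith), one_div_mul_cancel hm0,
      Real.rpow_one]
  have hN : Tendsto (fun n : ℕ => (n : ℝ) + 1) atTop atTop :=
    tendsto_atTop_add_const_right _ _ tendsto_natCast_atTop_atTop
  have hfl : Tendsto (fun n : ℕ => (⌊(1 - b) * ((n : ℝ) + 1)⌋₊ : ℝ) / ((n : ℝ) + 1)) atTop
      (nhds (1 - b)) :=
    (tendsto_nat_floor_mul_div_atTop (R := ℝ) (by linarith : 0 ≤ 1 - b)).comp hN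
  have hfac : ∀ k ∈ Finset.range m, Tendsto (fun n : ℕ =>
      ((n + 1 - ⌊(1 - b) * ((n : ℝ) + 1)⌋₊ + k : ℕ) : ℝ) / ((n : ℝ) + 1 + k)) atTop (nhds b) := by
    intro k _
    have hk : Tendsto (fun n : ℕ => (k : ℝ) / ((n : ℝ) + 1)) atTop (nhds 0) :=
      tendsto_const_nhds.div_atTop hN
    have h2 := ((tendsto_const_nhds (x := (1 : ℝ))).sub hfl).add hk
    have h3 := h2.div ((tendsto_const_nhds (x := (1 : ℝ))).add hk) (by norm_num)
    have h4 : (1 - (1 - b) + 0) / (1 + 0) = b := by ring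
    rw [h4] at h3
    refine h3.congr fun n => ?_
    have hp : (0 : ℝ) < (n : ℝ) + 1 := by positivity
    have hle : ⌊(1 - b) * ((n : ℝ) + 1)⌋₊ ≤ n + 1 := by
      apply Nat.floor_le_of_le
      push_cast
      nlinarith
    have hq : (0 : ℝ) < (n : ℝ) + 1 + k := by positivity
    rw [Nat.cast_add, Nat.cast_sub hle]
    push_cast
    simp only [Pi.div_apply]
    field_simp
  have hprod := tendsto_finsetProd (Finset.range m) hfac
  rw [Finset.prod_const, Finset.card_range, hbm] at hprod
  have h5 := (tendsto_const_nhds (x := (1 : ℝ))).sub hprod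
  rw [sub_sub_cancel] at h5
  refine h5.congr fun n => ?_
  rw [Finset.prod_div_distrib]
  have h6 : (((n + m)! : ℕ) : ℝ) = (n ! : ℝ) * ∏ k ∈ Finset.range m, ((n : ℝ) + 1 + k) := by
    rw [← Nat.factorial_mul_ascFactorial, Nat.ascFactorial_eq_prod_range]
    push_cast
    rfl
  have h7 : (n ! : ℝ) ≠ 0 := by exact_mod_cast Nat.factorial_ne_zero n
  have h8 : ∏ k ∈ Finset.range m, ((n : ℝ) + 1 + k) ≠ 0 :=
    Finset.prod_ne_zero_iff.mpr fun k _ => by positivity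
  rw [h6]
  field_simp
end

section
/- Let n ≥ 1, m ≥ 1 be integers and let t_1 ≤ t_2 ≤ ⋯ ≤ t_m be integers in {0,…,n}. Define functions g_0, g_1, …, g_m : ℕ → ℕ recursively by g_0(y) = 1 for all y, and g_j(x) = ∑_{y = t_j + 1}^{x} g_{j-1}(y) for j = 1,…,m (the sum being empty, hence zero, when x ≤ t_j). Then g_m(n+1) equals the number of tuples (x_1,…,x_m) with x_1 ≤ x_2 ≤ ⋯ ≤ x_m and t_j + 1 ≤ x_j ≤ n+1 for each j = 1,…,m. -/
open Nat Finset

theorem count_aux (g : ℕ → ℕ → ℕ) (hg0 : ∀ y, g 0 y = 1) (m : ℕ) :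
    ∀ (t : Fin m → ℕ) (_ : ∀ (j : Fin m) (x : ℕ),
      g (j.val + 1) x = ∑ y ∈ Finset.Icc (t j + 1) x, g j.val y) (N : ℕ),
    g m N
      = ((Fintype.piFinset fun j : Fin m => Finset.Icc (t j + 1) N).filter
          (fun x => ∀ i k : Fin m, i ≤ k → x i ≤ x k)).card := by
  induction m with
  | zero =>
    intro t _ N
    rw [hg0, Finset.filter_true_of_mem]
    · simp
    · intro x _ i
      exact i.elim0
  | succ m ih =>
    intro t h N
    have h1 := h (Fin.last m) N
    simp only [Fin.val_last] at h1
    rw [h1, Finset.card_eq_sum_card_fiberwise (f := fun x => x (Fin.last m))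
      (t := Finset.Icc (t (Fin.last m) + 1) N)]
    · refine Finset.sum_congr rfl fun y hy => ?_
      rw [ih (fun j => t j.castSucc) (fun j x => h j.castSucc x) y]
      rw [Finset.mem_Icc] at hy
      refine Finset.card_bij' (fun x _ => (Fin.snoc x y : Fin (m + 1) → ℕ))
        (fun x _ => fun j => x j.castSucc) ?_ ?_ ?_ ?_
      · intro x hx
        simp only [Finset.mem_filter, Fintype.mem_piFinset, Finset.mem_Icc] at hx ⊢
        refine ⟨⟨?_, ?_⟩, by simp⟩
        · intro j
          refine Fin.lastCases ?_ (fun j => ?_) j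
          · simpa using hy
          · simpa using ⟨(hx.1 j).1, (hx.1 j).2.trans hy.2⟩
        · intro i k
          refine Fin.lastCases ?_ (fun k => ?_) k <;> refine Fin.lastCases ?_ (fun i => ?_) i
          · simp
          · intro _
            simpa using (hx.1 i).2
          · intro hik
            exact absurd hik (not_le.2 (Fin.castSucc_lt_last k))
          · intro hik
            simpa using hx.2 i k (by simpa using hik)
      · intro x hx
        simp only [Finset.mem_filter, Fintype.mem_piFinset, Finset.mem_Icc] at hx ⊢
        refine ⟨fun j => ⟨(hx.1.1 _).1, ?_⟩, fun i k hik => hx.1.2 _ _ (by simpa using hik)⟩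
        rw [← hx.2]
        exact hx.1.2 _ _ (Fin.le_last _)
      · intro x hx
        funext j
        simp
      · intro x hx
        simp only [Finset.mem_filter] at hx
        funext j
        refine Fin.lastCases ?_ (fun j => ?_) j
        · simpa using hx.2.symm
        · simp
    · intro x hx
      simp only [Finset.coe_filter, Set.mem_setOf_eq, Fintype.mem_piFinset] at hx
      exact hx.1 _

/-- **Counting part of Lemma A.3.** Let `t_1 ≤ ⋯ ≤ t_m` be thresholds in `{0,…,n}` and
define `g_0(y) = 1`, `g_j(x) = ∑_{y = t_j + 1}^{x} g_{j-1}(y)`. Then `g_m(n+1)` is the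
number of tuples `x_1 ≤ ⋯ ≤ x_m` with `t_j + 1 ≤ x_j ≤ n+1` for each `j`. -/
theorem recursive_count_order_set (n m : ℕ) (hn : 1 ≤ n) (hm : 1 ≤ m)
    (t : Fin m → ℕ) (ht_mono : Monotone t) (ht_le : ∀ j, t j ≤ n)
    (g : ℕ → ℕ → ℕ)
    (hg0 : ∀ y, g 0 y = 1)
    (hgrec : ∀ (j : Fin m) (x : ℕ),
      g (j.val + 1) x = ∑ y ∈ Finset.Icc (t j + 1) x, g j.val y) :
    g m (n + 1)
      = ((Fintype.piFinset fun j : Fin m => Finset.Icc (t j + 1) (n + 1)).filter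
          (fun x => ∀ i k : Fin m, i ≤ k → x i ≤ x k)).card := by
  exact count_aux g hg0 m t hgrec (n + 1)
end

section
/- (Simes inequality / exact FDR for conformal p-values under the global null.) Let q ∈ (0,1) and let X = (X_1,…,X_m) be uniformly distributed on O_{n,m}. Then m·⌊q(n+1)/m⌋/(n+1) ≤ ℙ(∃ j ∈ {1,…,m} : X_j/(n+1) ≤ j·q/m) ≤ q. In particular, when q(n+1)/m is an integer, ℙ(∃ j : X_j/(n+1) ≤ j·q/m) = q exactly. -/
open Nat Finset
open scoped ENNReal

/-- Nondecreasing tuples with entries in `{1,…,N}`. -/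
def MonT (N m : ℕ) : Finset (Fin m → ℕ) :=
  (Fintype.piFinset fun _ : Fin m => Finset.Icc 1 N).filter
    (fun x => ∀ i k : Fin m, i ≤ k → x i ≤ x k)

lemma mem_MonT {N m : ℕ} {x : Fin m → ℕ} :
    x ∈ MonT N m ↔ (∀ i, 1 ≤ x i ∧ x i ≤ N) ∧ ∀ i k : Fin m, i ≤ k → x i ≤ x k := by
  simp [MonT, Fintype.mem_piFinset]

open Classical in
lemma card_rec (N m : ℕ) (P : (Fin (m+1) → ℕ) → Prop) :
    ((MonT (N+1) (m+1)).filter P).card = ((MonT N (m+1)).filter P).card +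
      ((MonT (N+1) m).filter (fun y => P (Fin.snoc (α := fun _ => ℕ) y (N+1)))).card := by
  have h1 : (MonT (N+1) (m+1)).filter P = ((MonT N (m+1)).filter P) ∪
      ((MonT (N+1) m).filter (fun y => P (Fin.snoc (α := fun _ => ℕ) y (N+1)))).image
        (fun y => Fin.snoc (α := fun _ => ℕ) y (N+1)) := by
    ext x
    simp only [Finset.mem_union, Finset.mem_filter, Finset.mem_image, mem_MonT]
    constructor
    · rintro ⟨⟨h1, h2⟩, hP⟩
      by_cases hx : x (Fin.last m) = N + 1
      · right
        have e : Fin.snoc (α := fun _ => ℕ) (Fin.init (α := fun _ => ℕ) x) (N+1) = x := by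
          rw [← hx]; exact Fin.snoc_init_self x
        refine ⟨Fin.init (α := fun _ => ℕ) x, ⟨⟨fun i => h1 _, fun i k hik => h2 _ _ ?_⟩, ?_⟩, e⟩
        · simpa using hik
        · rw [e]; exact hP
      · left
        refine ⟨⟨fun i => ⟨(h1 i).1, ?_⟩, h2⟩, hP⟩
        have := h2 i (Fin.last m) (Fin.le_last i)
        have := (h1 (Fin.last m)).2
        omega
    · rintro (⟨⟨h1, h2⟩, hP⟩ | ⟨y, ⟨⟨h1, h2⟩, hP⟩, rfl⟩)
      · exact ⟨⟨fun i => ⟨(h1 i).1, (h1 i).2.trans (by omega)⟩, h2⟩, hP⟩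
      · refine ⟨⟨fun i => ?_, fun i k hik => ?_⟩, hP⟩
        · induction i using Fin.lastCases with
          | last => simp
          | cast i => simpa using h1 i
        · induction k using Fin.lastCases with
          | last =>
            induction i using Fin.lastCases with
            | last => simp
            | cast i => simpa using (h1 i).2
          | cast k =>
            induction i using Fin.lastCases with
            | last =>
              exfalso
              have := k.isLt
              simp [Fin.le_def] at hik
              omega
            | cast i => simpa using h2 i k (by simpa using hik)
  rw [h1, Finset.card_union_of_disjoint, Finset.card_image_of_injective]
  · intro y z hyz
    have := congrArg (Fin.init (α := fun _ => ℕ)) hyz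
    simpa using this
  · rw [Finset.disjoint_left]
    intro x hx hx'
    simp only [Finset.mem_filter, Finset.mem_image, mem_MonT] at hx hx'
    obtain ⟨y, _, rfl⟩ := hx'
    have := (hx.1.1 (Fin.last m)).2
    simp at this

lemma card_zero (N : ℕ) : (MonT N 0).card = 1 := by
  rw [Finset.card_eq_one]
  refine ⟨Fin.elim0, ?_⟩
  ext x
  simp only [mem_MonT, Finset.mem_singleton]
  exact ⟨fun _ => Subsingleton.elim _ _, fun _ => ⟨fun i => i.elim0, fun i => i.elim0⟩⟩

lemma card_zero' (m : ℕ) : (MonT 0 (m+1)).card = 0 := by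
  rw [Finset.card_eq_zero, Finset.eq_empty_iff_forall_notMem]
  intro x hx
  have := (mem_MonT.1 hx).1 0
  omega

lemma card_MonT (m : ℕ) : ∀ N, (MonT N (m+1)).card = (N + m).choose (m+1) := by
  induction m with
  | zero =>
    intro N
    induction N with
    | zero => simp [card_zero']
    | succ N ih =>
      have := card_rec N 0 (fun _ => True)
      simp only [Finset.filter_true] at this
      rw [this, ih, card_zero]; simp
  | succ m ihm =>
    intro N
    induction N with
    | zero => rw [card_zero']; simp
    | succ N ih =>
      have := card_rec N (m+1) (fun _ => True)
      simp only [Finset.filter_true] at this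
      rw [this, ih, ihm, show N + 1 + (m+1) = (N + m + 1) + 1 by ring,
        Nat.choose_succ_succ (N+m+1) (m+1), show N + 1 + m = N + m + 1 by ring,
        show N + (m+1) = N + m + 1 by ring]
      simp [add_comm]

open Classical in
/-- The number of tuples with a crossing. -/
noncomputable def fc (b : ℕ → ℕ) (m N : ℕ) : ℕ :=
  ((MonT N m).filter (fun x => ∃ j : Fin m, x j ≤ b (j+1))).card

lemma fc_zero (b : ℕ → ℕ) (N : ℕ) : fc b 0 N = 0 := by
  simp [fc]

lemma fc_base (b : ℕ → ℕ) (m : ℕ) :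
    fc b (m+1) (b (m+1)) = (b (m+1) + m).choose (m+1) := by
  classical
  rw [fc, ← card_MonT, Finset.filter_true_of_mem]
  intro x hx
  exact ⟨Fin.last m, by simpa using ((mem_MonT.1 hx).1 (Fin.last m)).2⟩

lemma fc_succ (b : ℕ → ℕ) (m N : ℕ) (h : b (m+1) ≤ N) :
    fc b (m+1) (N+1) = fc b (m+1) N + fc b m (N+1) := by
  classical
  have r := card_rec N m (fun x => ∃ j : Fin (m+1), x j ≤ b (j+1))
  unfold fc
  refine Eq.trans (by congr!) (r.trans ?_)
  refine congrArg₂ (· + ·) (by congr!) ?_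
  congr 1
  ext y
  simp only [Finset.mem_filter]
  refine and_congr_right fun _ => ?_
  constructor
  · rintro ⟨j, hj⟩
    induction j using Fin.lastCases with
    | last => simp at hj; omega
    | cast j => exact ⟨j, by simpa using hj⟩
  · rintro ⟨j, hj⟩
    exact ⟨j.castSucc, by simpa using hj⟩

lemma choose_rel (b m : ℕ) : (b + m).choose (m+1) * (m+1) = (b+m).choose m * b := by
  rw [Nat.choose_succ_right_eq]; simp

lemma fc_bound (b : ℕ → ℕ) (hb : Monotone b) (a k : ℝ)
    (h1 : ∀ j : ℕ, k * j ≤ b j) (h2 : ∀ j : ℕ, (b j : ℝ) ≤ a * j) (m : ℕ) :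
    ∀ N, b (m+1) ≤ N → k * ((N + m).choose m : ℝ) ≤ fc b (m+1) N ∧
      (fc b (m+1) N : ℝ) ≤ a * ((N + m).choose m : ℝ) := by
  have base : ∀ m : ℕ, k * ((b (m+1) + m).choose m : ℝ) ≤ fc b (m+1) (b (m+1)) ∧
      (fc b (m+1) (b (m+1)) : ℝ) ≤ a * ((b (m+1) + m).choose m : ℝ) := by
    intro m
    rw [fc_base]
    have e : (((b (m+1) + m).choose (m+1) : ℕ) : ℝ) * (m+1) = ((b (m+1) + m).choose m : ℕ) * b (m+1) := by
      exact_mod_cast choose_rel (b (m+1)) m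
    have h1 := h1 (m+1)
    have h2 := h2 (m+1)
    push_cast at h1 h2
    have hp : (0:ℝ) < m + 1 := by positivity
    have hc : (0:ℝ) ≤ ((b (m+1) + m).choose m : ℕ) := by positivity
    constructor
    · refine le_of_mul_le_mul_right ?_ hp
      rw [e]; nlinarith [mul_le_mul_of_nonneg_left h1 hc]
    · refine le_of_mul_le_mul_right ?_ hp
      rw [e]; nlinarith [mul_le_mul_of_nonneg_left h2 hc]
  induction m with
  | zero =>
    intro N hN
    induction N, hN using Nat.le_induction with
    | base => exact base 0
    | succ N hN ih =>
      rw [fc_succ b 0 N hN, fc_zero]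
      simpa using ih
  | succ m ihm =>
    intro N hN
    induction N, hN using Nat.le_induction with
    | base => exact base (m+1)
    | succ N hN ih =>
      have i2 := ihm (N+1) ((hb (by omega : m+1 ≤ m+1+1)).trans (hN.trans (by omega)))
      rw [fc_succ b (m+1) N hN, show N + 1 + (m+1) = (N + m + 1) + 1 by ring,
        Nat.choose_succ_succ (N+m+1) m]
      rw [show N + 1 + m = N + m + 1 by ring] at i2
      rw [show N + (m+1) = N + m + 1 by ring] at ih
      push_cast
      constructor <;> linarith [ih.1, ih.2, i2.1, i2.2]

lemma event_bound (n m : ℕ) (hm : 1 ≤ m)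
    (hne : (Onm n m).Nonempty) (q : ℝ) (hq : q ∈ Set.Ioo (0 : ℝ) 1) :
    ∃ p : ℝ, (PMF.uniformOfFinset (Onm n m) hne).toOuterMeasure
            {x | ∃ j : Fin m, ((x j : ℕ) : ℝ) / (n + 1) ≤ ((j : ℕ) + 1) * q / m} = ENNReal.ofReal p ∧
      (m : ℝ) * (⌊q * (n + 1) / m⌋₊ : ℝ) / (n + 1) ≤ p ∧ p ≤ q := by
  classical
  obtain ⟨m, rfl⟩ : ∃ m', m = m' + 1 := ⟨m - 1, by omega⟩
  obtain ⟨hq0, hq1⟩ := hq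
  set a : ℝ := q * (n+1) / ((m+1 : ℕ) : ℝ) with ha
  have hM : (0:ℝ) < ((m+1 : ℕ) : ℝ) := by positivity
  have hN : (0:ℝ) < (n:ℝ) + 1 := by positivity
  have ha0 : 0 ≤ a := by positivity
  have ham : a * ((m+1 : ℕ) : ℝ) = q * (n+1) := by rw [ha]; field_simp
  let b : ℕ → ℕ := fun j => ⌊a * j⌋₊
  have hb : Monotone b := by
    intro i j hij
    apply Nat.floor_mono
    gcongr
  have hbN : b (m+1) ≤ n + 1 := by
    apply Nat.floor_le_of_le
    rw [ham]; push_cast; nlinarith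
  have key := fc_bound b hb a ⌊a⌋₊ (fun j => by
      have : ⌊a⌋₊ * j ≤ b j := by
        apply Nat.le_floor
        push_cast
        gcongr
        exact Nat.floor_le ha0
      exact_mod_cast this) (fun j => Nat.floor_le (by positivity)) m (n+1) hbN
  have hcard : (Onm n (m+1)).card = (n+1+m).choose (m+1) := card_MonT m (n+1)
  have hset : ((Onm n (m+1)).filter (fun x => x ∈ {x : Fin (m+1) → ℕ | ∃ j : Fin (m+1),
      ((x j : ℕ) : ℝ) / (n + 1) ≤ ((j : ℕ) + 1) * q / ((m+1 : ℕ) : ℝ)})).card = fc b (m+1) (n+1) := by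
    unfold fc
    congr 1
    apply Finset.filter_congr
    intro x _
    simp only [Set.mem_ofPred_eq]
    apply exists_congr
    intro j
    rw [Nat.le_floor_iff (by positivity), div_le_iff₀ hN]
    apply Eq.to_iff
    congr 1
    rw [ha]; push_cast; ring
  have e : (((n+1+m).choose (m+1) : ℕ) : ℝ) * ((m+1:ℕ):ℝ) = ((n+1+m).choose m : ℕ) * ((n:ℝ)+1) := by
    exact_mod_cast choose_rel (n+1) m
  have hpos : (0:ℝ) < ((n+1+m).choose (m+1) : ℕ) := by
    exact_mod_cast Nat.choose_pos (by omega)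
  refine ⟨(fc b (m+1) (n+1) : ℝ) / ((n+1+m).choose (m+1) : ℕ), ?_, ?_, ?_⟩
  · rw [PMF.toOuterMeasure_uniformOfFinset_apply, hcard, ENNReal.ofReal_div_of_pos hpos,
      ENNReal.ofReal_natCast, ENNReal.ofReal_natCast, ← hset]
    congr!
  · rw [div_le_div_iff₀ hN hpos]
    nlinarith [mul_le_mul_of_nonneg_right key.1 hN.le]
  · rw [div_le_iff₀ hpos]
    refine le_of_mul_le_mul_right ?_ hN
    refine (mul_le_mul_of_nonneg_right key.2 hN.le).trans (le_of_eq ?_)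
    rw [mul_assoc, ← e, mul_comm (((n+1+m).choose (m+1) : ℕ) : ℝ), ← mul_assoc, ham]
    ring

/-- **Simes inequality / exact FDR for conformal p-values under the global null.**
Let `q ∈ (0,1)` and let `X = (X_1,…,X_m)` be uniformly distributed on `O_{n,m}` (so
`X/(n+1)` is the vector of ordered conformal p-values). Then
`m·⌊q(n+1)/m⌋/(n+1) ≤ ℙ(∃ j ∈ {1,…,m} : X_j/(n+1) ≤ j·q/m) ≤ q`, with equality
`ℙ(…) = q` when `q(n+1)/m` is an integer; the event is the event that the BH procedure at
level `q` makes at least one rejection. -/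
theorem simes_conformal (n m : ℕ) (hn : 1 ≤ n) (hm : 1 ≤ m)
    (hne : (Onm n m).Nonempty) (q : ℝ) (hq : q ∈ Set.Ioo (0 : ℝ) 1) :
    (ENNReal.ofReal ((m : ℝ) * (⌊q * (n + 1) / m⌋₊ : ℝ) / (n + 1))
        ≤ (PMF.uniformOfFinset (Onm n m) hne).toOuterMeasure
            {x | ∃ j : Fin m, ((x j : ℕ) : ℝ) / (n + 1) ≤ ((j : ℕ) + 1) * q / m})
    ∧ ((PMF.uniformOfFinset (Onm n m) hne).toOuterMeasure
            {x | ∃ j : Fin m, ((x j : ℕ) : ℝ) / (n + 1) ≤ ((j : ℕ) + 1) * q / m}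
          ≤ ENNReal.ofReal q)
    ∧ (∀ k : ℕ, q * (n + 1) / m = (k : ℝ) →
        (PMF.uniformOfFinset (Onm n m) hne).toOuterMeasure
            {x | ∃ j : Fin m, ((x j : ℕ) : ℝ) / (n + 1) ≤ ((j : ℕ) + 1) * q / m}
          = ENNReal.ofReal q) := by
  obtain ⟨p, hp, h1, h2⟩ := event_bound n m hm hne q hq
  rw [hp]
  refine ⟨ENNReal.ofReal_le_ofReal h1, ENNReal.ofReal_le_ofReal h2, ?_⟩
  intro k hk
  congr 1
  apply le_antisymm h2
  refine le_trans (le_of_eq ?_) h1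
  rw [hk, Nat.floor_natCast, ← hk]
  have : (m:ℝ) ≠ 0 := by positivity
  field_simp
end

section
/- (Hochberg procedure controls the FWER for conformal p-values under the global null.) Let α ∈ (0,1) and let X = (X_1,…,X_m) be uniformly distributed on O_{n,m}. Then ℙ(∃ j ∈ {1,…,m} : X_j/(n+1) ≤ α/(m−j+1)) ≤ α; that is, under the global null the Hochberg step-up procedure at level α applied to the conformal p-values makes at least one (false) rejection with probability at most α. -/
open Nat Finset
open scoped ENNReal

lemma greedy (N : ℕ) (c : ℕ → ℝ) (hc : ∀ i, 0 ≤ c i) (l : ℝ) (hl : 0 ≤ l) (B : ℕ → Prop) [DecidablePred B]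
    (hB : ∀ s, B s → ∃ v, 1 ≤ v ∧ v ≤ N ∧ l * v ≤ ∑ i ∈ range v, c (s + i)) (L : ℕ) :
    ∀ s, l * (∑ i ∈ range L, if B (s + i) then (1:ℝ) else 0) ≤ ∑ i ∈ range (L + N), c (s + i) := by
  induction L using Nat.strong_induction_on with
  | _ L ih =>
  intro s
  rcases Nat.eq_zero_or_pos L with h0 | h0
  · subst h0
    simpa using Finset.sum_nonneg (fun i _ => hc _)
  by_cases hs : B s
  · obtain ⟨v, h1, h2, h3⟩ := hB s hs
    have hle : ∀ t k, (∑ i ∈ range k, if B (t + i) then (1:ℝ) else 0) ≤ k := by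
      intro t k
      calc _ ≤ ∑ i ∈ range k, (1:ℝ) := Finset.sum_le_sum (fun i _ => by split_ifs <;> norm_num)
        _ = k := by simp
    by_cases hv : L ≤ v
    · calc _ ≤ l * L := mul_le_mul_of_nonneg_left (hle s L) hl
        _ ≤ l * v := mul_le_mul_of_nonneg_left (by exact_mod_cast hv) hl
        _ ≤ _ := h3
        _ ≤ _ := Finset.sum_le_sum_of_subset_of_nonneg (by
            intro x; simp only [Finset.mem_range]; omega) (fun _ _ _ => hc _)
    · push Not at hv
      obtain ⟨w, rfl⟩ := Nat.exists_eq_add_of_le hv.le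
      have := ih w (by omega) (s + v)
      rw [Finset.sum_range_add, add_assoc, Finset.sum_range_add, mul_add]
      have h4 := mul_le_mul_of_nonneg_left (hle s v) hl
      simp only [← add_assoc] at *
      linarith
  · obtain ⟨w, rfl⟩ : ∃ w, L = w + 1 := ⟨L - 1, by omega⟩
    have := ih w (by omega) (s + 1)
    rw [Finset.sum_range_succ', show w + 1 + N = (w + N) + 1 by ring, Finset.sum_range_succ']
    have h5 := hc (s + 0)
    simp only [add_zero, hs, if_false] at *
    simp only [add_comm _ 1, ← add_assoc] at *
    linarith

lemma sum_zmod (N : ℕ) [NeZero N] (f : ZMod N → ℝ) (K : ℕ) :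
    ∑ i ∈ range (K * N), f (i : ZMod N) = K * ∑ a, f a := by
  have base : ∑ i ∈ range N, f (i : ZMod N) = ∑ a, f a := by
    refine Finset.sum_bij (fun i _ => (i : ZMod N)) (by simp) ?_ ?_ (by simp)
    · intro a ha b hb h
      rw [ZMod.natCast_eq_natCast_iff'] at h
      simp only [Finset.mem_range] at ha hb
      rwa [Nat.mod_eq_of_lt ha, Nat.mod_eq_of_lt hb] at h
    · intro b _
      exact ⟨b.val, by simpa using ZMod.val_lt b, by simp⟩
  induction K with
  | zero => simp
  | succ K ih =>
    rw [add_mul, one_mul, Finset.sum_range_add, ih]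
    push_cast
    simp [base]; ring

lemma maximal (N : ℕ) [NeZero N] (f : ZMod N → ℝ) (hf : ∀ a, 0 ≤ f a) (l : ℝ) (hl : 0 ≤ l)
    (B : ZMod N → Prop) [DecidablePred B]
    (hB : ∀ s, B s → ∃ v, 1 ≤ v ∧ v ≤ N ∧ l * v ≤ ∑ i ∈ range v, f (s + i)) :
    l * (#{s | B s} : ℝ) ≤ ∑ a, f a := by
  have key : ∀ K : ℕ, K * (l * (#{s | B s} : ℝ)) ≤ (K + 1) * ∑ a, f a := by
    intro K
    have := greedy N (fun i => f i) (fun i => hf _) l hl (fun i => B i)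
      (fun s hs => by simpa using hB s hs) (K * N) 0
    simp only [zero_add] at this
    rw [sum_zmod N (fun a => if B a then (1:ℝ) else 0), show K * N + N = (K + 1) * N by ring, sum_zmod] at this
    simp only [Finset.sum_boole] at this
    push_cast at this
    linarith
  by_contra! h
  obtain ⟨K, hK⟩ := exists_nat_gt ((∑ a, f a) / (l * (#{s | B s} : ℝ) - ∑ a, f a))
  rw [div_lt_iff₀ (by linarith)] at hK
  linarith [key K]

/-- bad compositions -/
def Bad (N m : ℕ) (α : ℝ) (c : ZMod N → ℕ) : Prop :=
  ∃ v : ℕ, 1 ≤ v ∧ v ≤ N ∧ (m : ℝ) * v ≤ ∑ i ∈ range v, α * N * (c ((i : ZMod N) + 1) : ℝ)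

open Classical in
lemma bad_count (N m : ℕ) [NeZero N] (hm : 1 ≤ m) (α : ℝ) (hα : 0 ≤ α) :
    ((#{c ∈ Finset.piAntidiag (Finset.univ : Finset (ZMod N)) m | Bad N m α c} : ℕ) : ℝ)
      ≤ α * (#(Finset.piAntidiag (Finset.univ : Finset (ZMod N)) m) : ℝ) := by
  set S := Finset.piAntidiag (Finset.univ : Finset (ZMod N)) m with hS
  have memS : ∀ c, c ∈ S ↔ ∑ a, c a = m := by intro c; simp [hS, Finset.mem_piAntidiag]
  have hN : (0:ℝ) < N := by exact_mod_cast Nat.pos_of_ne_zero (NeZero.ne N)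
  have hmR : (0:ℝ) < m := by exact_mod_cast hm
  -- each c
  have h1 : ∀ c ∈ S, (#{s : ZMod N | Bad N m α (fun a => c (s + a))} : ℝ) ≤ α * N := by
    intro c hc
    rw [memS] at hc
    have := maximal N (fun a => α * N * (c (a + 1) : ℝ)) (fun a => by positivity) m hmR.le
      (fun s => Bad N m α (fun a => c (s + a))) (by
        rintro s ⟨v, a, b, h⟩
        exact ⟨v, a, b, by simpa [add_assoc] using h⟩)
    rw [← Finset.mul_sum, Fintype.sum_equiv (Equiv.addRight (1 : ZMod N)) _ (fun a => (c a : ℝ)) (by simp), ← Nat.cast_sum, hc, mul_comm (α * N)] at this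
    exact le_of_mul_le_mul_left this hmR
  have h2 : ∀ s : ZMod N, #{c ∈ S | Bad N m α (fun a => c (s + a))} = #{c ∈ S | Bad N m α c} := by
    intro s
    refine Finset.card_bij (fun c _ => fun a => c (s + a)) ?_ ?_ ?_
    · intro c hc
      simp only [Finset.mem_filter, memS] at hc ⊢
      refine ⟨?_, hc.2⟩
      rw [← hc.1]
      exact Fintype.sum_equiv (Equiv.addLeft s) _ _ (by simp)
    · intro c _ d _ h
      funext a
      simpa using congrFun h (a - s)
    · intro d hd
      refine ⟨fun a => d (a - s), ?_, by simp⟩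
      simp only [Finset.mem_filter, memS] at hd ⊢
      refine ⟨?_, by simpa using hd.2⟩
      rw [← hd.1]
      exact Fintype.sum_equiv (Equiv.subRight s) _ _ (by simp)
  have h3 : ∑ c ∈ S, #{s : ZMod N | Bad N m α (fun a => c (s + a))} = N * #{c ∈ S | Bad N m α c} := by
    simp only [Finset.card_filter]
    rw [Finset.sum_comm]
    simp only [← Finset.card_filter, h2]
    simp [ZMod.card]
  have h4 := Finset.sum_le_sum h1
  rw [← Nat.cast_sum, h3] at h4
  simp only [Finset.sum_const, nsmul_eq_mul] at h4
  push_cast at h4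
  refine le_of_mul_le_mul_left ?_ hN
  linarith

/-- the section of the cast to ZMod with values in Icc 1 N -/
def gsec (n : ℕ) (a : ZMod (n + 1)) : ℕ := (a - 1).val + 1

lemma cast_gsec (n : ℕ) (a : ZMod (n + 1)) : ((gsec n a : ℕ) : ZMod (n + 1)) = a := by
  unfold gsec
  rw [Nat.cast_add, ZMod.natCast_zmod_val]; simp

lemma gsec_mem (n : ℕ) (a : ZMod (n + 1)) : gsec n a ∈ Finset.Icc 1 (n + 1) := by
  have := ZMod.val_lt (a - 1)
  simp only [gsec, Finset.mem_Icc]; omega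

lemma gsec_cast (n k : ℕ) (hk : k ∈ Finset.Icc 1 (n + 1)) : gsec n (k : ZMod (n + 1)) = k := by
  rw [Finset.mem_Icc] at hk
  obtain ⟨j, rfl⟩ : ∃ j, k = j + 1 := ⟨k - 1, by omega⟩
  unfold gsec
  rw [Nat.cast_add, Nat.cast_one, add_sub_cancel_right, ZMod.val_natCast_of_lt (by omega)]

/-- count vector -/
def cvec (n m : ℕ) (x : Fin m → ℕ) (a : ZMod (n + 1)) : ℕ := #{i | (x i : ZMod (n + 1)) = a}

lemma cvec_eq (n m : ℕ) (x : Fin m → ℕ) (a : ZMod (n + 1)) :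
    cvec n m x a = Multiset.count a ((Finset.univ.val.map x).map (fun k : ℕ => (k : ZMod (n + 1)))) := by
  rw [Multiset.map_map, Multiset.count_map]
  simp only [cvec, Finset.card_def, Finset.filter_val, Function.comp]
  congr 1
  exact Multiset.filter_congr (fun i _ => eq_comm)

lemma mem_Onm (n m : ℕ) (x : Fin m → ℕ) :
    x ∈ Onm n m ↔ (∀ i, x i ∈ Finset.Icc 1 (n + 1)) ∧ Monotone x := by
  simp only [Onm, Finset.mem_filter, Fintype.mem_piFinset]
  exact Iff.rfl

lemma cvec_inj (n m : ℕ) (x y : Fin m → ℕ) (hx : x ∈ Onm n m) (hy : y ∈ Onm n m)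
    (h : cvec n m x = cvec n m y) : x = y := by
  rw [mem_Onm] at hx hy
  have h1 : (Finset.univ.val.map x).map (fun k : ℕ => (k : ZMod (n + 1)))
      = (Finset.univ.val.map y).map (fun k : ℕ => (k : ZMod (n + 1))) := by
    ext a
    rw [← cvec_eq, ← cvec_eq, h]
  have h2 := congrArg (Multiset.map (gsec n)) h1
  simp only [Multiset.map_map, Function.comp_def, gsec_cast n _ (hx.1 _), gsec_cast n _ (hy.1 _)] at h2
  rw [Fin.univ_val_map, Fin.univ_val_map, Multiset.coe_eq_coe] at h2
  have h3 := h2.eq_of_sortedLE (List.sortedLE_ofFn_iff.2 hx.2) (List.sortedLE_ofFn_iff.2 hy.2)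
  exact List.ofFn_injective h3

lemma cvec_surj (n m : ℕ) (c : ZMod (n + 1) → ℕ) (hc : ∑ a, c a = m) :
    ∃ x ∈ Onm n m, cvec n m x = c := by
  set M : Multiset ℕ := ∑ a, Multiset.replicate (c a) (gsec n a) with hM
  have hl : (M.sort (· ≤ ·)).length = m := by
    rw [Multiset.length_sort, hM, Multiset.card_sum]
    simpa using hc
  obtain ⟨x, hx⟩ : ∃ x : Fin m → ℕ, List.ofFn x = M.sort (· ≤ ·) := by
    subst hl
    exact ⟨_, List.ofFn_get _⟩
  have hxM : Finset.univ.val.map x = M := by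
    rw [Fin.univ_val_map, hx, Multiset.sort_eq]
  refine ⟨x, (mem_Onm _ _ _).2 ⟨?_, ?_⟩, ?_⟩
  · intro i
    have : x i ∈ M := by rw [← hxM]; simp
    rw [hM, Multiset.mem_sum] at this
    obtain ⟨a, _, ha⟩ := this
    rw [Multiset.eq_of_mem_replicate ha]
    exact gsec_mem n a
  · rw [← List.sortedLE_ofFn_iff, hx]
    exact (Multiset.pairwise_sort _ _).sortedLE
  · funext a
    rw [cvec_eq, hxM, hM, ← Multiset.coe_mapAddMonoidHom, map_sum, Multiset.count_sum']
    simp [cast_gsec, Multiset.count_replicate]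

lemma cvec_bad (n m : ℕ) (α : ℝ) (hα : 0 ≤ α) (x : Fin m → ℕ) (hx : x ∈ Onm n m)
    (h : ∃ j : Fin m, ((x j : ℕ) : ℝ) / (n + 1) ≤ α / ((m - (j : ℕ) : ℕ) : ℝ)) :
    Bad (n + 1) m α (cvec n m x) := by
  rw [mem_Onm] at hx
  obtain ⟨j, hj⟩ := h
  have hjm := j.2
  have hxj := Finset.mem_Icc.1 (hx.1 j)
  obtain ⟨d, hd⟩ : ∃ d, m = j + d + 1 := ⟨m - j - 1, by omega⟩
  rw [show m - (j : ℕ) = d + 1 by omega, div_le_div_iff₀ (by positivity) (by positivity)] at hj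
  refine ⟨x j, hxj.1, hxj.2, ?_⟩
  have hF : (j : ℕ) + 1 ≤ ∑ i ∈ range (x j), cvec n m x ((i : ZMod (n + 1)) + 1) := by
    calc (j : ℕ) + 1 = #(Finset.Iic j) := by simp
      _ ≤ #((range (x j)).biUnion fun i => ({k | (x k : ZMod (n + 1)) = (i : ZMod (n + 1)) + 1} : Finset (Fin m))) := by
        apply Finset.card_le_card
        intro k hk
        have hk1 := hx.2 (Finset.mem_Iic.1 hk)
        have hk2 := Finset.mem_Icc.1 (hx.1 k)
        simp only [Finset.mem_biUnion, Finset.mem_range, Finset.mem_filter, Finset.mem_univ, true_and]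
        refine ⟨x k - 1, by omega, ?_⟩
        rw [Nat.cast_sub hk2.1]; simp
      _ ≤ _ := Finset.card_biUnion_le
  have hF' : ((j : ℕ) : ℝ) + 1 ≤ ∑ i ∈ range (x j), (cvec n m x ((i : ZMod (n + 1)) + 1) : ℝ) := by
    exact_mod_cast hF
  rw [← Finset.mul_sum]
  have e : (m : ℝ) = (j : ℕ) + d + 1 := by exact_mod_cast hd
  have hN : (0:ℝ) ≤ α * ((n + 1 : ℕ) : ℝ) := by positivity
  refine le_trans ?_ (mul_le_mul_of_nonneg_left hF' hN)
  rw [e]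
  push_cast
  have h1 := mul_le_mul_of_nonneg_left hj (show (0:ℝ) ≤ ((j : ℕ) : ℝ) + 1 by positivity)
  have h2 : (0:ℝ) ≤ ((j : ℕ) : ℝ) * d * (x j : ℝ) := by positivity
  push_cast at h1
  nlinarith

/-- **Corollary 1: the Hochberg procedure controls the FWER for conformal p-values under
the global null.** Let `α ∈ (0,1)` and let `X = (X_1,…,X_m)` be uniformly distributed on
`O_{n,m}` (so `X/(n+1)` is the vector of ordered conformal p-values). Then
`ℙ(∃ j ∈ {1,…,m} : X_j/(n+1) ≤ α/(m−j+1)) ≤ α`, i.e.\ the Hochberg step-up procedure at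
level `α` makes at least one (false) rejection with probability at most `α`. -/
theorem hochberg_controls_FWER (n m : ℕ) (hn : 1 ≤ n) (hm : 1 ≤ m)
    (hne : (Onm n m).Nonempty) (α : ℝ) (hα : α ∈ Set.Ioo (0 : ℝ) 1) :
    (PMF.uniformOfFinset (Onm n m) hne).toOuterMeasure
        {x | ∃ j : Fin m, ((x j : ℕ) : ℝ) / (n + 1) ≤ α / ((m - (j : ℕ) : ℕ) : ℝ)}
      ≤ ENNReal.ofReal α := by
  classical
  have hα0 := hα.1.le
  rw [PMF.toOuterMeasure_uniformOfFinset_apply]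
  have hpos : 0 < #(Onm n m) := hne.card_pos
  have hb := bad_count (n + 1) m hm α hα0
  have hS : #(Finset.piAntidiag (Finset.univ : Finset (ZMod (n + 1))) m) ≤ #(Onm n m) := by
    apply Finset.card_le_card_of_surjOn (cvec n m)
    intro c hc
    have hc' : ∑ a, c a = m := by simpa [Finset.mem_piAntidiag] using hc
    obtain ⟨x, hx, e⟩ := cvec_surj n m c hc'
    exact ⟨x, hx, e⟩
  have hI : #{x ∈ Onm n m | x ∈ {x : Fin m → ℕ | ∃ j : Fin m, ((x j : ℕ) : ℝ) / (n + 1) ≤ α / ((m - (j : ℕ) : ℕ) : ℝ)}}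
      ≤ #{c ∈ Finset.piAntidiag (Finset.univ : Finset (ZMod (n + 1))) m | Bad (n + 1) m α c} := by
    apply Finset.card_le_card_of_injOn (cvec n m)
    · intro x hx
      have hx' := Finset.mem_filter.1 (Finset.mem_coe.1 hx)
      refine Finset.mem_coe.2 (Finset.mem_filter.2 ⟨?_, cvec_bad n m α hα0 x hx'.1 hx'.2⟩)
      rw [Finset.mem_piAntidiag]
      refine ⟨?_, by simp⟩
      have := Finset.card_eq_sum_card_fiberwise (s := (Finset.univ : Finset (Fin m)))
        (t := (Finset.univ : Finset (ZMod (n + 1)))) (f := fun i => (x i : ZMod (n + 1))) (by simp)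
      rw [Finset.card_univ, Fintype.card_fin] at this
      exact this.symm
    · intro x hx y hy h
      exact cvec_inj n m x y (Finset.mem_filter.1 (Finset.mem_coe.1 hx)).1
        (Finset.mem_filter.1 (Finset.mem_coe.1 hy)).1 h
  apply ENNReal.div_le_of_le_mul
  rw [← ENNReal.ofReal_natCast, ← ENNReal.ofReal_natCast, ← ENNReal.ofReal_mul hα0]
  apply ENNReal.ofReal_le_ofReal
  have hS' := (Nat.cast_le (α := ℝ)).2 hS
  refine le_trans (le_trans ?_ hb) (mul_le_mul_of_nonneg_left hS' hα0)
  refine Nat.cast_le.2 ?_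
  convert hI
end
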